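/- Let d be a self-adjoint operator on a Hilbert space with δ·1 ≤ d ≤ δ^{-1}·1 for some 0 < δ < 1, and let k ∈ ℕ, k ≥ 1. Then there exists a self-adjoint operator d' with finite spectrum such that (1 + 1/k)^{-1} d ≤ d' ≤ (1 + 1/k) d and the number of distinct points in the spectrum of d' is at most 2k·δ^{-2} + 1 (i.e., O(k δ^{-2})). -/

import Mathlib

/-- Projection onto the kernel of a bounded operator. -/
lemma exists_ker_projection {H : Type*} [NormedAddCommGroup H]
    [InnerProductSpace ℂ H] [CompleteSpace H] (b : H →L[ℂ] H) :
    ∃ P : H →L[ℂ] H, IsSelfAdjoint P ∧ P * P = P ∧ b * P = 0 ∧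
      ∀ w : H →L[ℂ] H, b * w = 0 → P * w = w := by
  haveI : CompleteSpace (LinearMap.ker (b : H →ₗ[ℂ] H)) :=
    (ContinuousLinearMap.isClosed_ker b).completeSpace_coe
  refine ⟨(LinearMap.ker (b : H →ₗ[ℂ] H)).starProjection, isSelfAdjoint_starProjection _,
    Submodule.isIdempotentElem_starProjection _, ?_, ?_⟩
  · ext v
    have h := Submodule.starProjection_apply_mem (LinearMap.ker (b : H →ₗ[ℂ] H)) v
    exact LinearMap.mem_ker.mp h
  · intro w hw
    ext v
    have h : w v ∈ LinearMap.ker (b : H →ₗ[ℂ] H) := by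
      have := congrArg (fun T : H →L[ℂ] H => T v) hw
      simpa using this
    simpa using Submodule.starProjection_eq_self_iff.mpr h

lemma norm_le_of_between {H : Type*} [NormedAddCommGroup H]
    [InnerProductSpace ℂ H] [CompleteSpace H] [Nontrivial H] (y : H →L[ℂ] H)
    (hy : IsSelfAdjoint y) (e : ℝ)
    (h1 : y ≤ algebraMap ℝ _ e) (h2 : algebraMap ℝ _ (-e) ≤ y) : ‖y‖ ≤ e := by
  rw [le_algebraMap_iff_spectrum_le] at h1
  rw [algebraMap_le_iff_le_spectrum] at h2
  rcases CStarAlgebra.norm_or_neg_norm_mem_spectrum hy with h | h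
  · exact h1 _ h
  · linarith [h2 _ h]

/-- The sign of a self-adjoint operator. -/
lemma exists_sign {H : Type*} [NormedAddCommGroup H]
    [InnerProductSpace ℂ H] [CompleteSpace H] [Nontrivial H] (x : H →L[ℂ] H)
    (hx : IsSelfAdjoint x) (r : ℝ) (hr : ‖x‖ ≤ r) :
    ∃ s : H →L[ℂ] H, IsSelfAdjoint s ∧ s * s = 1 ∧
      (∀ z, Commute x z → Commute s z) ∧ ‖x - algebraMap ℝ _ (r / 2) * s‖ ≤ r / 2 := by
  obtain ⟨P, hP, hPP, hb, hw⟩ := exists_ker_projection (x⁺)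
  have hpos : IsSelfAdjoint x⁺ := .of_nonneg (CFC.posPart_nonneg x)
  have hPb : P * x⁺ = 0 := by
    have := congrArg star hb
    simpa [hP.star_eq, hpos.star_eq] using this
  have hPn : P * x⁻ = x⁻ := hw _ (CFC.posPart_mul_negPart x)
  have hs2 : (1 - (2 : ℝ) • P) * (1 - (2 : ℝ) • P) = 1 := by
    simp only [mul_sub, sub_mul, mul_one, one_mul, smul_mul_smul, hPP]
    module
  have hsa : IsSelfAdjoint (1 - (2 : ℝ) • P) := by
    simp [IsSelfAdjoint, hP.star_eq]
  refine ⟨1 - (2 : ℝ) • P, hsa, hs2, ?_, ?_⟩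
  · have key : ∀ z, Commute x z → P * (z * P) = z * P := by
      intro z hz
      apply hw
      have h : Commute x⁺ z := hz.cfcₙ_real _
      rw [← mul_assoc, h.eq, mul_assoc, hb, mul_zero]
    intro z hz
    have hz' : Commute x (star z) := by
      have := hz.star_star
      rwa [hx.star_eq] at this
    have h1 := key z hz
    have h2 := congrArg star (key _ hz')
    simp only [star_mul, star_star, hP.star_eq] at h2
    have h3 : Commute P z := by
      show P * z = z * P
      rw [← h2, mul_assoc, h1]
    exact (Commute.one_left z).sub_left (h3.smul_left _)
  · have habs : x = (1 - (2 : ℝ) • P) * CFC.abs x := by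
      rw [← CFC.posPart_add_negPart x hx]
      conv_lhs => rw [← CFC.posPart_sub_negPart x hx]
      simp only [sub_mul, mul_add, one_mul, smul_mul_assoc, hPb, hPn]
      module
    have heq : x - algebraMap ℝ _ (r / 2) * (1 - (2 : ℝ) • P)
        = (1 - (2 : ℝ) • P) * (CFC.abs x - algebraMap ℝ _ (r / 2)) := by
      rw [mul_sub (1 - (2 : ℝ) • P), ← habs, Algebra.commutes]
    have hu : (1 - (2 : ℝ) • P) ∈ unitary (H →L[ℂ] H) := by
      rw [Unitary.mem_iff, hsa.star_eq]
      exact ⟨hs2, hs2⟩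
    rw [heq, CStarRing.norm_mem_unitary_mul _ hu]
    have h0 : 0 ≤ CFC.abs x := CFC.abs_nonneg x
    have h1 : CFC.abs x ≤ algebraMap ℝ _ r := by
      rw [← CStarAlgebra.norm_le_iff_le_algebraMap _ ((norm_nonneg _).trans hr) h0]
      simpa using hr
    apply norm_le_of_between
    · exact (IsSelfAdjoint.of_nonneg h0).sub (IsSelfAdjoint.algebraMap _ (IsSelfAdjoint.all _))
    · rw [sub_le_iff_le_add, ← map_add]
      simpa using h1
    · rw [le_sub_iff_add_le, ← map_add]
      simpa using h0

lemma spectrum_add_sign {A : Type*} [Ring A] [Algebra ℂ A] (y s : A)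
    (hs : s * s = 1) (hc : Commute s y) (c l : ℂ)
    (h1 : l - c ∉ spectrum ℂ y) (h2 : l + c ∉ spectrum ℂ y) :
    l ∉ spectrum ℂ (y + c • s) := by
  rw [spectrum.notMem_iff] at *
  obtain ⟨u, hu⟩ := h1
  obtain ⟨v, hv⟩ := h2
  have su : Commute s u := by
    rw [hu]; exact (Algebra.commute_algebraMap_right _ s).sub_right hc
  have sv : Commute s v := by
    rw [hv]; exact (Algebra.commute_algebraMap_right _ s).sub_right hc
  have su' : Commute s ↑u⁻¹ := su.units_inv_right
  have sv' : Commute s ↑v⁻¹ := sv.units_inv_right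
  set T := algebraMap ℂ A l - (y + c • s) with hT
  have e1 : T * (1 + s) = u * (1 + s) := by
    rw [hu, hT]; simp only [Algebra.algebraMap_eq_smul_one, sub_mul, add_mul, mul_add, sub_smul,
      smul_mul_assoc, one_mul, mul_one, hs]; abel
  have e2 : T * (1 - s) = v * (1 - s) := by
    rw [hv, hT]; simp only [Algebra.algebraMap_eq_smul_one, sub_mul, add_mul, mul_sub, add_smul,
      smul_mul_assoc, one_mul, mul_one, hs]; abel
  have sT : Commute s T := by
    rw [hT]
    exact (Algebra.commute_algebraMap_right _ s).sub_right (hc.add_right ((Commute.refl s).smul_right c))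
  have yT : Commute y T := by
    rw [hT]
    exact (Algebra.commute_algebraMap_right _ y).sub_right ((Commute.refl y).add_right (hc.symm.smul_right c))
  have uT : Commute (u : A) T := by
    rw [hu]; exact (Algebra.commute_algebraMap_left _ T).sub_left yT
  have vT : Commute (v : A) T := by
    rw [hv]; exact (Algebra.commute_algebraMap_left _ T).sub_left yT
  have right : T * ((1 + s) * ↑u⁻¹ + (1 - s) * ↑v⁻¹) = (2 : ℂ) • (1 : A) := by
    rw [mul_add, ← mul_assoc, ← mul_assoc, e1, e2,
      (((Commute.one_left (u : A)).add_left su).symm).eq,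
      (((Commute.one_left (v : A)).sub_left sv).symm).eq, mul_assoc, mul_assoc]
    simp only [Units.mul_inv, mul_one]
    module
  have hcomm : Commute T ((1 + s) * ↑u⁻¹ + (1 - s) * ↑v⁻¹) := by
    refine Commute.add_right (Commute.mul_right ?_ ?_) (Commute.mul_right ?_ ?_)
    · exact (Commute.one_right T).add_right sT.symm
    · exact uT.symm.units_inv_right
    · exact (Commute.one_right T).sub_right sT.symm
    · exact vT.symm.units_inv_right
  refine ⟨⟨T, (2⁻¹ : ℂ) • ((1 + s) * ↑u⁻¹ + (1 - s) * ↑v⁻¹), ?_, ?_⟩, rfl⟩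
  · rw [mul_smul_comm, right, smul_smul]; norm_num
  · rw [smul_mul_assoc, ← hcomm.eq, right, smul_smul]; norm_num

lemma dyadic_approx {H : Type*} [NormedAddCommGroup H]
    [InnerProductSpace ℂ H] [CompleteSpace H] [Nontrivial H] (n : ℕ) :
    ∀ (x : H →L[ℂ] H) (r : ℝ), IsSelfAdjoint x → ‖x‖ ≤ r →
    ∃ y : H →L[ℂ] H, IsSelfAdjoint y ∧ (∀ z, Commute x z → Commute y z) ∧
      (∃ S : Finset ℂ, spectrum ℂ y ⊆ S ∧ S.card ≤ 2 ^ n) ∧ ‖x - y‖ ≤ r / 2 ^ n := by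
  classical
  induction n with
  | zero =>
    intro x r hx hr
    refine ⟨0, IsSelfAdjoint.zero _, fun z _ => Commute.zero_left z, ⟨{0}, ?_, by simp⟩, by simpa⟩
    simp
  | succ n ih =>
    intro x r hx hr
    obtain ⟨s, hs, hss, hsc, hn⟩ := exists_sign x hx r hr
    have hsa : IsSelfAdjoint (algebraMap ℝ (H →L[ℂ] H) (r / 2) * s) := by
      rw [← Algebra.smul_def]
      exact (IsSelfAdjoint.all (r / 2)).smul hs
    have hcc : ∀ z, Commute x z → Commute (algebraMap ℝ (H →L[ℂ] H) (r / 2) * s) z := fun z hz =>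
      Commute.mul_left (Algebra.commutes _ z) (hsc z hz)
    obtain ⟨y, hy, hyc, ⟨S, hS, hcard⟩, hyn⟩ := ih _ (r / 2) (hx.sub hsa) hn
    have hsy : Commute s y := by
      refine (hyc s ?_).symm
      exact Commute.sub_left (hsc x (Commute.refl x)).symm (hcc s (hsc x (Commute.refl x)).symm)
    refine ⟨y + algebraMap ℝ _ (r / 2) * s, hy.add hsa, ?_,
      ⟨S.image (· + ((r / 2 : ℝ) : ℂ)) ∪ S.image (· - ((r / 2 : ℝ) : ℂ)), ?_, ?_⟩, ?_⟩
    · intro z hz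
      exact (hyc z (hz.sub_left (hcc z hz))).add_left (hcc z hz)
    · intro l hl
      by_contra hcon
      have e : algebraMap ℝ (H →L[ℂ] H) (r / 2) * s = ((r / 2 : ℝ) : ℂ) • s := by
        rw [← Algebra.smul_def, Complex.coe_smul]
      rw [e] at hl
      refine spectrum_add_sign y s hss hsy _ l ?_ ?_ hl
      · intro h
        apply hcon
        simp only [Finset.coe_union, Finset.coe_image]
        exact Or.inl ⟨_, hS h, by simp⟩
      · intro h
        apply hcon
        simp only [Finset.coe_union, Finset.coe_image]
        exact Or.inr ⟨_, hS h, by simp⟩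
    · refine (Finset.card_union_le _ _).trans ?_
      have a1 := Finset.card_image_le (s := S) (f := (· + ((r / 2 : ℝ) : ℂ)))
      have a2 := Finset.card_image_le (s := S) (f := (· - ((r / 2 : ℝ) : ℂ)))
      rw [pow_succ]; omega
    · rw [pow_succ', ← div_div, add_comm, ← sub_sub]
      exact hyn

/-- Approximation by finite-spectrum operators: if `d` is a self-adjoint operator with
`δ·1 ≤ d ≤ δ⁻¹·1` for some `0 < δ < 1`, then for every `k ≥ 1` there is a self-adjoint
operator `d'` with finite spectrum of at most `2k·δ⁻² + 1` points such that
`(1 + 1/k)⁻¹ d ≤ d' ≤ (1 + 1/k) d` in the Loewner order. -/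
theorem finite_spectrum_approximation {H : Type*} [NormedAddCommGroup H]
    [InnerProductSpace ℂ H] [CompleteSpace H]
    (d : H →L[ℂ] H) (hd : IsSelfAdjoint d) (δ : ℝ) (hδ0 : 0 < δ) (hδ1 : δ < 1)
    (hlow : (d - (δ : ℂ) • (1 : H →L[ℂ] H)).IsPositive)
    (hhigh : (((δ⁻¹ : ℝ) : ℂ) • (1 : H →L[ℂ] H) - d).IsPositive)
    (k : ℕ) (hk : 1 ≤ k) :
    ∃ d' : H →L[ℂ] H, IsSelfAdjoint d' ∧ (spectrum ℂ d').Finite ∧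
      ((spectrum ℂ d').ncard : ℝ) ≤ 2 * k * δ⁻¹ ^ 2 + 1 ∧
      (d' - (((1 + 1 / (k : ℝ))⁻¹ : ℝ) : ℂ) • d).IsPositive ∧
      ((((1 + 1 / (k : ℝ)) : ℝ) : ℂ) • d - d').IsPositive := by
  rcases subsingleton_or_nontrivial H with hH | hH
  · have h0 : ∀ T : H →L[ℂ] H, T = 0 := fun T => by ext v; exact Subsingleton.elim _ _
    have hsp : spectrum ℂ (0 : H →L[ℂ] H) = ∅ := by
      haveI : Subsingleton (H →L[ℂ] H) := ⟨fun a b => by rw [h0 a, h0 b]⟩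
      exact spectrum.of_subsingleton _
    refine ⟨0, IsSelfAdjoint.zero _, by simp [hsp], by rw [hsp]; simp; positivity, ?_, ?_⟩
    · rw [h0 (_ - _)]; exact ContinuousLinearMap.isPositive_zero
    · rw [h0 (_ - _)]; exact ContinuousLinearMap.isPositive_zero
  have hk1 : (1 : ℝ) ≤ k := by exact_mod_cast hk
  have hk0 : (0 : ℝ) < k := by linarith
  have hinv : 1 < δ⁻¹ := (one_lt_inv₀ hδ0).2 hδ1
  -- the number of bisections
  obtain ⟨n, hn1, hn2⟩ : ∃ n : ℕ, (2 : ℝ) ^ n ≤ 2 * k * δ⁻¹ ^ 2 + 1 ∧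
      (δ⁻¹ ^ 2 - 1) * (k + 1) / 2 ≤ 2 ^ n := by
    have hsq : 1 < δ⁻¹ ^ 2 := one_lt_pow₀ hinv (by norm_num)
    rcases le_total 1 ((δ⁻¹ ^ 2 - 1) * (k + 1) / 2) with h | h
    · obtain ⟨m, hm1, hm2⟩ := exists_nat_pow_near h (one_lt_two (α := ℝ))
      refine ⟨m + 1, ?_, hm2.le⟩
      rw [pow_succ]
      nlinarith
    · refine ⟨0, ?_, by simpa using h⟩
      have : 0 ≤ 2 * (k : ℝ) * δ⁻¹ ^ 2 := by positivity
      simpa using this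
  have hal : ∀ t : ℝ, ((t : ℂ) • (1 : H →L[ℂ] H)) = algebraMap ℝ _ t := fun t => by
    rw [Algebra.algebraMap_eq_smul_one, Complex.coe_smul]
  rw [hal, ← ContinuousLinearMap.nonneg_iff_isPositive] at hlow hhigh
  set c : ℝ := (δ + δ⁻¹) / 2 with hc
  have hsac : ∀ t : ℝ, IsSelfAdjoint (algebraMap ℝ (H →L[ℂ] H) t) := fun t =>
    IsSelfAdjoint.algebraMap _ (IsSelfAdjoint.all _)
  have hx : IsSelfAdjoint (d - algebraMap ℝ _ c) := hd.sub (hsac c)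
  have hxn : ‖d - algebraMap ℝ _ c‖ ≤ (δ⁻¹ - δ) / 2 := by
    apply norm_le_of_between _ hx
    · rw [sub_le_iff_le_add, ← map_add, ← sub_nonneg]
      convert hhigh using 3
      rw [hc]; ring
    · rw [le_sub_iff_add_le, ← map_add, ← sub_nonneg]
      convert hlow using 3
      rw [hc]; ring
  obtain ⟨y, hy, -, ⟨S, hS, hcard⟩, hyn⟩ := dyadic_approx n _ _ hx hxn
  have hsp : spectrum ℂ (y + algebraMap ℝ _ c) ⊆ ((S.image (· + (c : ℂ)) : Finset ℂ) : Set ℂ) := by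
    intro l hl
    have e : algebraMap ℝ (H →L[ℂ] H) c = algebraMap ℂ _ (c : ℂ) := by
      rw [← hal, Algebra.algebraMap_eq_smul_one]
    rw [e, add_comm, ← spectrum.singleton_add_eq] at hl
    obtain ⟨a, ha, b, hb, rfl⟩ := hl
    rw [Set.mem_singleton_iff] at ha
    subst ha
    simp only [Finset.coe_image]
    exact ⟨b, hS hb, add_comm _ _⟩
  set d' := y + algebraMap ℝ (H →L[ℂ] H) c with hd'
  have hsa' : IsSelfAdjoint d' := hy.add (hsac c)
  have hdiff : ‖d - d'‖ ≤ δ / (k + 1) := by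
    have : d - d' = d - algebraMap ℝ _ c - y := by rw [hd']; abel
    rw [this]
    refine hyn.trans ?_
    rw [div_le_div_iff₀ (by positivity) (by positivity)]
    have h3 := mul_le_mul_of_nonneg_left hn2 hδ0.le
    have h4 : δ * ((δ⁻¹ ^ 2 - 1) * (k + 1) / 2) = (δ⁻¹ - δ) / 2 * (k + 1) := by
      field_simp
    linarith
  have hE : ∀ T : H →L[ℂ] H, IsSelfAdjoint T → ‖T‖ ≤ δ / (k + 1) →
      0 ≤ algebraMap ℝ _ (δ / (k + 1)) - T := fun T hT hTn =>
    sub_nonneg.2 (hT.le_algebraMap_norm_self.trans (algebraMap_mono _ hTn))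
  have hlow1 := hE _ (hd.sub hsa') hdiff
  have hlow2 := hE _ (hsa'.sub hd) (by rwa [norm_sub_rev])
  refine ⟨d', hsa', (Finset.finite_toSet _).subset hsp, ?_, ?_, ?_⟩
  · refine le_trans ?_ hn1
    have h1 := Set.ncard_le_ncard hsp (Finset.finite_toSet _)
    rw [Set.ncard_coe_finset] at h1
    exact_mod_cast h1.trans (Finset.card_image_le.trans hcard)
  · rw [← ContinuousLinearMap.nonneg_iff_isPositive, Complex.coe_smul]
    have h2 : 0 ≤ (1 / ((k : ℝ) + 1)) • (d - algebraMap ℝ _ δ) :=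
      smul_nonneg (by positivity) hlow
    convert add_nonneg hlow1 h2 using 1
    have : (1 + 1 / (k : ℝ))⁻¹ = 1 - 1 / (k + 1) := by field_simp; ring
    rw [this, Algebra.algebraMap_eq_smul_one, Algebra.algebraMap_eq_smul_one]
    module
  · rw [← ContinuousLinearMap.nonneg_iff_isPositive, Complex.coe_smul]
    have h2 : 0 ≤ (1 / (k : ℝ)) • (d - algebraMap ℝ _ δ) :=
      smul_nonneg (by positivity) hlow
    have h3 : 0 ≤ algebraMap ℝ (H →L[ℂ] H) (δ / k - δ / (k + 1)) := by
      apply algebraMap_nonneg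
      rw [sub_nonneg]
      gcongr
      linarith
    convert add_nonneg (add_nonneg hlow2 h2) h3 using 1
    simp only [Algebra.algebraMap_eq_smul_one]
    module
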